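/- Let R₁, R₂ : ℝ → S(E) be smooth maps with R₁(t) ≥ R₂(t) for all t ∈ ℝ. For i = 1, 2, let Sᵢ : (0, tᵢ) → S(E) be a solution of the Riccati equation Sᵢ' + Sᵢ² + Rᵢ = 0 which cannot be extended beyond tᵢ. Assume that U := S₂ − S₁ has a continuous extension to t = 0 with U(0) ≥ 0. Then t₁ ≤ t₂ and S₁(t) ≤ S₂(t) for all t ∈ (0, t₁). -/

import Mathlib

open scoped RealInnerProductSpace

open Set Filter Topology

/-- A nonautonomous `C¹` ordinary differential equation has local solutions. -/
theorem exists_hasDerivAt_of_contDiff {G : Type*} [NormedAddCommGroup G] [NormedSpace ℝ G]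
    [CompleteSpace G] {F : ℝ × G → G} (hF : ContDiff ℝ 1 F) (t₀ : ℝ) (x₀ : G) :
    ∃ α : ℝ → G, α t₀ = x₀ ∧ ∃ ε > (0 : ℝ),
      ∀ t ∈ Ioo (t₀ - ε) (t₀ + ε), HasDerivAt α (F (t, α t)) t := by
  have hG : ContDiff ℝ 1 fun p : ℝ × G => ((1 : ℝ), F p) := contDiff_const.prodMk hF
  obtain ⟨β, hβ₀, ε, hε, hβ⟩ :=
    (hG.contDiffAt (x := (t₀, x₀))).exists_forall_mem_closedBall_exists_eq_forall_mem_Ioo_hasDerivAt₀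
      t₀
  have hfst : ∀ t ∈ Ioo (t₀ - ε) (t₀ + ε), HasDerivAt (fun s => (β s).1) 1 t :=
    fun t ht => (hβ t ht).fst
  have hmem : t₀ ∈ Ioo (t₀ - ε) (t₀ + ε) := ⟨by linarith, by linarith⟩
  have htime : ∀ t ∈ Ioo (t₀ - ε) (t₀ + ε), (β t).1 = t := by
    intro t ht
    have h := isOpen_Ioo.is_const_of_deriv_eq_zero (f := fun s => (β s).1 - s)
      (convex_Ioo _ _).isPreconnected
      (fun s hs => ((hfst s hs).sub (hasDerivAt_id s)).differentiableAt.differentiableWithinAt)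
      (fun s hs => ((hfst s hs).sub (hasDerivAt_id s)).deriv.trans (sub_self 1)) ht hmem
    simp only [hβ₀, sub_self] at h
    linarith
  refine ⟨fun s => (β s).2, by simp [hβ₀], ε, hε, fun t ht => ?_⟩
  have h := (hβ t ht).snd
  rwa [show β t = (t, (β t).2) from Prod.ext (htime t ht) rfl] at h

section

variable {E : Type*} [NormedAddCommGroup E] [InnerProductSpace ℝ E] [FiniteDimensional ℝ E]

/-- The Riccati equation has local self-adjoint solutions with self-adjoint initial data. -/
theorem exists_isSelfAdjoint_riccati {R : ℝ → E →L[ℝ] E} (hR : ContDiff ℝ 1 R)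
    (hRsa : ∀ t, IsSelfAdjoint (R t)) (t₀ : ℝ) {A : E →L[ℝ] E} (hA : IsSelfAdjoint A) :
    ∃ S : ℝ → E →L[ℝ] E, S t₀ = A ∧ ∃ ε > (0 : ℝ), ∀ t ∈ Ioo (t₀ - ε) (t₀ + ε),
      IsSelfAdjoint (S t) ∧ HasDerivAt S (-(S t * S t) - R t) t := by
  let Y : (E →L[ℝ] E) → E →L[ℝ] E := fun B => (2⁻¹ : ℝ) • (B + star B)
  have hYsa : ∀ B, IsSelfAdjoint (Y B) := fun B =>
    (IsSelfAdjoint.all (2⁻¹ : ℝ)).smul (IsSelfAdjoint.add_star_self B)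
  have hstar : ContDiff ℝ 1 (star : (E →L[ℝ] E) → E →L[ℝ] E) :=
    (starL' ℝ : (E →L[ℝ] E) ≃L[ℝ] (E →L[ℝ] E)).contDiff
  have hY : ContDiff ℝ 1 Y := (contDiff_id.add hstar).const_smul _
  have hF : ContDiff ℝ 1 fun p : ℝ × (E →L[ℝ] E) => -(Y p.2 * Y p.2) - R p.1 :=
    (((hY.comp contDiff_snd).mul (hY.comp contDiff_snd)).neg).sub (hR.comp contDiff_fst)
  obtain ⟨S, hS₀, ε, hε, hS⟩ := exists_hasDerivAt_of_contDiff hF t₀ A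
  have hmem : t₀ ∈ Ioo (t₀ - ε) (t₀ + ε) := ⟨by linarith, by linarith⟩
  have hvf : ∀ t, IsSelfAdjoint (-(Y (S t) * Y (S t)) - R t) := fun t =>
    (by simpa [pow_two] using ((hYsa (S t)).pow 2) : IsSelfAdjoint (Y (S t) * Y (S t))).neg.sub
      (hRsa t)
  have hdiff : ∀ t ∈ Ioo (t₀ - ε) (t₀ + ε), HasDerivAt (fun s => star (S s) - S s) 0 t := by
    intro t ht
    have h := (hS t ht).star.sub (hS t ht)
    rwa [(hvf t).star_eq, sub_self] at h
  have hsa : ∀ t ∈ Ioo (t₀ - ε) (t₀ + ε), IsSelfAdjoint (S t) := by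
    intro t ht
    have h := isOpen_Ioo.is_const_of_deriv_eq_zero (convex_Ioo _ _).isPreconnected
      (fun s hs => (hdiff s hs).differentiableAt.differentiableWithinAt)
      (fun s hs => (hdiff s hs).deriv) ht hmem
    simp only [hS₀, hA.star_eq, sub_self] at h
    exact sub_eq_zero.mp h
  refine ⟨S, hS₀, ε, hε, fun t ht => ⟨hsa t ht, ?_⟩⟩
  have hYS : Y (S t) = S t := by
    simp only [Y, (hsa t ht).star_eq, ← two_smul ℝ (S t), smul_smul]
    norm_num
  simpa only [hYS] using hS t ht

/-- A bounded self-adjoint solution of the Riccati equation extends past the endpoint. -/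
theorem exists_riccati_extension {R : ℝ → E →L[ℝ] E} (hR : ContDiff ℝ 1 R)
    (hRsa : ∀ t, IsSelfAdjoint (R t)) {S : ℝ → E →L[ℝ] E} {a b T C : ℝ} (hab : a ≤ b) (hbT : b < T)
    (hSsa : ∀ t ∈ Ioo a T, IsSelfAdjoint (S t))
    (hS : ∀ t ∈ Ioo a T, HasDerivAt S (-(S t * S t) - R t) t)
    (hbound : ∀ t ∈ Ioo b T, ‖S t‖ ≤ C) :
    ∃ T' > T, ∃ Q : ℝ → E →L[ℝ] E, (∀ t ∈ Ioo a T', IsSelfAdjoint (Q t)) ∧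
      (∀ t ∈ Ioo a T', HasDerivAt Q (-(Q t * Q t) - R t) t) ∧ ∀ t ∈ Ioo a T, Q t = S t := by
  have hsub : Ioo b T ⊆ Ioo a T := Ioo_subset_Ioo_left hab
  obtain ⟨K, hK⟩ := (isCompact_Icc (a := b) (b := T)).exists_bound_of_continuousOn
    hR.continuous.continuousOn
  have hlip : LipschitzOnWith (C * C + K).toNNReal S (Ioo b T) := by
    refine (convex_Ioo b T).lipschitzOnWith_of_nnnorm_hasDerivWithin_le
      (fun t ht => (hS t (hsub ht)).hasDerivWithinAt) fun t ht => ?_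
    rw [← NNReal.coe_le_coe, coe_nnnorm]
    refine le_trans ?_ (Real.le_coe_toNNReal _)
    have h1 := hbound t ht
    calc ‖-(S t * S t) - R t‖ ≤ ‖S t * S t‖ + ‖R t‖ := by
          simpa using norm_sub_le (-(S t * S t)) (R t)
      _ ≤ ‖S t‖ * ‖S t‖ + K := add_le_add (norm_mul_le _ _) (hK t (Ioo_subset_Icc_self ht))
      _ ≤ C * C + K := by gcongr; exact (norm_nonneg _).trans h1
  have hnhds : Ioo b T ∈ 𝓝[<] T := Ioo_mem_nhdsLT hbT
  obtain ⟨A, hSA⟩ : ∃ A, Tendsto S (𝓝[<] T) (𝓝 A) :=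
    CompleteSpace.complete ((cauchy_nhds.mono nhdsWithin_le_nhds).map_of_le
      hlip.uniformContinuousOn (le_principal_iff.mpr hnhds))
  have hA : IsSelfAdjoint A :=
    tendsto_nhds_unique (hSA.star.congr' (by
      filter_upwards [hnhds] with t ht using (hSsa t (hsub ht)).star_eq)) hSA
  obtain ⟨P, hP₀, ε, hε, hP⟩ := exists_isSelfAdjoint_riccati hR hRsa T hA
  let Q : ℝ → E →L[ℝ] E := fun t => if t < T then S t else P t
  have hQS : ∀ t, t < T → Q t = S t := fun t ht => if_pos ht
  have hQP : ∀ t, T ≤ t → Q t = P t := fun t ht => if_neg ht.not_gt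
  have hQT : Q T = A := (hQP T le_rfl).trans hP₀
  have hQderiv : ∀ t ∈ Ioo a T, HasDerivAt Q (-(Q t * Q t) - R t) t := by
    intro t ht
    rw [hQS t ht.2]
    refine (hS t ht).congr_of_eventuallyEq ?_
    filter_upwards [Iio_mem_nhds ht.2] with s hs using hQS s hs
  have hQtend : Tendsto Q (𝓝[<] T) (𝓝 A) :=
    hSA.congr' (by filter_upwards [self_mem_nhdsWithin] with s hs using (hQS s hs).symm)
  refine ⟨T + ε, by linarith, Q, fun t ht => ?_, fun t ht => ?_, fun t ht => hQS t ht.2⟩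
  · rcases lt_or_ge t T with h | h
    · rw [hQS t h]; exact hSsa t ⟨ht.1, h⟩
    · rw [hQP t h]; exact (hP t ⟨by linarith, ht.2⟩).1
  · rcases lt_trichotomy t T with h | rfl | h
    · exact hQderiv t ⟨ht.1, h⟩
    · have hleft : HasDerivWithinAt Q (-(A * A) - R t) (Iic t) t := by
        refine hasDerivWithinAt_Iic_of_tendsto_deriv (s := Ioo b t)
          (fun s hs => (hQderiv s (hsub hs)).differentiableAt.differentiableWithinAt) ?_ hnhds ?_
        · rw [ContinuousWithinAt, hQT]
          exact hQtend.mono_left (nhdsWithin_mono _ fun s hs => hs.2)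
        · refine Tendsto.congr' (f₁ := fun s => -(Q s * Q s) - R s) ?_
            ((hQtend.mul hQtend).neg.sub (hR.continuous.continuousAt.mono_left nhdsWithin_le_nhds))
          filter_upwards [hnhds] with s hs using (hQderiv s (hsub hs)).deriv.symm
      have hright : HasDerivWithinAt Q (-(A * A) - R t) (Ici t) t := by
        rw [← hP₀]
        exact (hP t ⟨by linarith, by linarith⟩).2.hasDerivWithinAt.congr (fun s hs => hQP s hs)
          (hQP t le_rfl)
      rw [hQT]
      simpa using hleft.union hright
    · rw [hQP t h.le]
      refine (hP t ⟨by linarith, ht.2⟩).2.congr_of_eventuallyEq ?_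
      filter_upwards [Ioi_mem_nhds h] with s hs using hQP s hs.le

/-- A self-adjoint operator whose quadratic form is bounded by `C` has norm at most `C`. -/
theorem IsSelfAdjoint.norm_le_of_abs_inner_le {A : E →L[ℝ] E} (hA : IsSelfAdjoint A) {C : ℝ}
    (hC : 0 ≤ C) (h : ∀ v, |⟪A v, v⟫| ≤ C * ‖v‖ ^ 2) : ‖A‖ ≤ C := by
  rw [A.norm_eq_iSup_rayleighQuotient (ContinuousLinearMap.isSelfAdjoint_iff_isSymmetric.mp hA)]
  refine ciSup_le fun v => ?_
  rw [ContinuousLinearMap.rayleighQuotient, ContinuousLinearMap.reApplyInnerSelf_apply, abs_div,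
    abs_of_nonneg (sq_nonneg ‖v‖)]
  exact div_le_of_le_mul₀ (sq_nonneg _) hC (h v)

/-- A null vector of a nonnegative quadratic form lies in the kernel. -/
theorem IsSelfAdjoint.apply_eq_zero_of_inner_eq_zero {A : E →L[ℝ] E} (hA : IsSelfAdjoint A)
    (hpos : ∀ v, 0 ≤ ⟪A v, v⟫) {v : E} (hv : ⟪A v, v⟫ = 0) : A v = 0 := by
  have hsymm : ⟪A (A v), v⟫ = ⟪A v, A v⟫ :=
    ContinuousLinearMap.isSelfAdjoint_iff_isSymmetric.mp hA (A v) v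
  have hquad : ∀ x : ℝ, 0 ≤ ⟪A (A v), A v⟫ * (x * x) + (2 * ⟪A v, A v⟫) * x + 0 := by
    intro x
    have h := hpos (v + x • A v)
    simp only [map_add, map_smul, inner_add_left, inner_add_right, real_inner_smul_left,
      real_inner_smul_right, hv, hsymm] at h
    linarith
  have h := discrim_le_zero hquad
  rw [discrim] at h
  have : ⟪A v, A v⟫ = 0 := by nlinarith [sq_nonneg ⟪A v, A v⟫]
  exact inner_self_eq_zero.mp this

/-- A path of self-adjoint operators which starts out positive definite, and whose derivative is
positive on its kernel, stays positive definite. -/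
theorem inner_pos_of_deriv_pos_on_ker {W W' : ℝ → E →L[ℝ] E} {a b : ℝ}
    (hW : ContinuousOn W (Icc a b)) (hsa : ∀ t ∈ Ioc a b, IsSelfAdjoint (W t))
    (hderiv : ∀ t ∈ Ioc a b, HasDerivAt W (W' t) t) (ha : ∀ v, v ≠ 0 → 0 < ⟪W a v, v⟫)
    (hker : ∀ t ∈ Ioc a b, ∀ v, v ≠ 0 → W t v = 0 → 0 < ⟪W' t v, v⟫) :
    ∀ t ∈ Icc a b, ∀ v, v ≠ 0 → 0 < ⟪W t v, v⟫ := by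
  by_contra! hcon
  obtain ⟨t₀, ht₀, v₀, hv₀, hneg₀⟩ := hcon
  let D : Set (ℝ × E) := Icc a b ×ˢ Metric.sphere 0 1
  have hDcompact : IsCompact D := isCompact_Icc.prod (isCompact_sphere 0 1)
  have hcont : ContinuousOn (fun p : ℝ × E => ⟪W p.1 p.2, p.2⟫) D :=
    ((hW.comp continuousOn_fst fun p hp => hp.1).clm_apply continuousOn_snd).inner continuousOn_snd
  have hZcompact : IsCompact (D ∩ (fun p : ℝ × E => ⟪W p.1 p.2, p.2⟫) ⁻¹' Iic 0) :=
    hDcompact.of_isClosed_subset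
      (hcont.preimage_isClosed_of_isClosed hDcompact.isClosed isClosed_Iic) inter_subset_left
  have hscale : ∀ (t : ℝ) (v : E), ⟪W t (‖v‖⁻¹ • v), ‖v‖⁻¹ • v⟫ = ‖v‖⁻¹ ^ 2 * ⟪W t v, v⟫ := by
    intro t v
    simp only [map_smul, real_inner_smul_left, real_inner_smul_right]
    ring
  have hunit : ∀ v : E, v ≠ 0 → ‖v‖⁻¹ • v ∈ Metric.sphere (0 : E) 1 := by
    intro v hv
    simp [norm_smul, norm_ne_zero_iff.mpr hv]
  obtain ⟨⟨s, u⟩, ⟨⟨hs, hu⟩, hsu⟩, hmin⟩ := hZcompact.exists_isMinOn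
    ⟨(t₀, ‖v₀‖⁻¹ • v₀), ⟨ht₀, hunit v₀ hv₀⟩, by
      simp only [mem_preimage, mem_Iic, hscale]
      exact mul_nonpos_of_nonneg_of_nonpos (sq_nonneg _) hneg₀⟩ continuousOn_fst
  simp only [mem_preimage, mem_Iic] at hsu hs hu
  have hu₀ : u ≠ 0 := ne_zero_of_mem_unit_sphere ⟨u, hu⟩
  have hlt : ∀ t ∈ Ico a s, ∀ v, v ≠ 0 → 0 < ⟪W t v, v⟫ := by
    intro t ht v hv
    by_contra! hneg
    have h := hmin (a := (t, ‖v‖⁻¹ • v)) ⟨⟨⟨ht.1, ht.2.le.trans hs.2⟩, hunit v hv⟩, by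
      simp only [mem_preimage, mem_Iic, hscale]
      exact mul_nonpos_of_nonneg_of_nonpos (sq_nonneg _) hneg⟩
    exact absurd ht.2 (not_lt.mpr h)
  have has : a < s := by
    refine lt_of_le_of_ne hs.1 ?_
    rintro rfl
    exact absurd (ha u hu₀) hsu.not_gt
  have hsIoc : s ∈ Ioc a b := ⟨has, hs.2⟩
  have hform : ∀ v, HasDerivAt (fun t => ⟪W t v, v⟫) ⟪W' s v, v⟫ s := by
    intro v
    simpa using ((hderiv s hsIoc).clm_apply (hasDerivAt_const s v)).inner ℝ (hasDerivAt_const s v)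
  have hIco : Ico a s ∈ 𝓝[<] s := Ico_mem_nhdsLT has
  have hnonneg : ∀ v, 0 ≤ ⟪W s v, v⟫ := by
    intro v
    rcases eq_or_ne v 0 with rfl | hv
    · simp
    · refine ge_of_tendsto ((hform v).continuousAt.tendsto.mono_left
        (nhdsWithin_le_nhds (s := Iio s))) ?_
      filter_upwards [hIco] with t ht using (hlt t ht v hv).le
  have hzero : ⟪W s u, u⟫ = 0 := le_antisymm hsu (hnonneg u)
  have hpos := hker s hsIoc u hu₀ ((hsa s hsIoc).apply_eq_zero_of_inner_eq_zero hnonneg hzero)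
  refine absurd hpos (not_lt.mpr ?_)
  have hslope := (hform u).tendsto_slope.mono_left
    (nhdsWithin_mono s fun t (ht : t ∈ Iio s) => ne_of_lt ht)
  refine le_of_tendsto hslope ?_
  filter_upwards [hIco] with t ht
  rw [slope_def_field, hzero, sub_zero]
  exact div_nonpos_of_nonneg_of_nonpos (hlt t ht u hu₀).le (by linarith [ht.2])

/-- The derivative of the quadratic form of a self-adjoint solution of the Riccati equation. -/
theorem hasDerivAt_inner_riccati {R S : ℝ → E →L[ℝ] E} {t : ℝ} (hsa : IsSelfAdjoint (S t))
    (hS : HasDerivAt S (-(S t * S t) - R t) t) (v : E) :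
    HasDerivAt (fun t => ⟪S t v, v⟫) (-‖S t v‖ ^ 2 - ⟪R t v, v⟫) t := by
  have h := (hS.clm_apply (hasDerivAt_const t v)).inner ℝ (hasDerivAt_const t v)
  have hsymm : ⟪S t (S t v), v⟫ = ⟪S t v, S t v⟫ :=
    ContinuousLinearMap.isSelfAdjoint_iff_isSymmetric.mp hsa (S t v) v
  simpa [inner_sub_left, hsymm] using h

/-- Self-adjoint solutions of the Riccati equation grow at most linearly. -/
theorem inner_riccati_le {R S : ℝ → E →L[ℝ] E} {s t K : ℝ} (hst : s ≤ t)
    (hsa : ∀ τ ∈ Icc s t, IsSelfAdjoint (S τ))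
    (hS : ∀ τ ∈ Icc s t, HasDerivAt S (-(S τ * S τ) - R τ) τ)
    (hR : ∀ τ ∈ Icc s t, ‖R τ‖ ≤ K) (v : E) :
    ⟪S t v, v⟫ ≤ ⟪S s v, v⟫ + K * ‖v‖ ^ 2 * (t - s) := by
  have hderiv := fun τ hτ => hasDerivAt_inner_riccati (hsa τ hτ) (hS τ hτ) v
  have h := (convex_Icc s t).image_sub_le_mul_sub_of_deriv_le (C := K * ‖v‖ ^ 2)
    (fun τ hτ => (hderiv τ hτ).continuousAt.continuousWithinAt)
    (fun τ hτ => (hderiv τ (interior_subset hτ)).differentiableAt.differentiableWithinAt)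
    (fun τ hτ => by
      rw [(hderiv τ (interior_subset hτ)).deriv]
      have h₁ := abs_real_inner_le_norm (R τ v) v
      have h₂ : ‖R τ v‖ * ‖v‖ ≤ K * ‖v‖ * ‖v‖ :=
        mul_le_mul_of_nonneg_right ((R τ).le_of_opNorm_le (hR τ (interior_subset hτ)) v)
          (norm_nonneg v)
      nlinarith [neg_abs_le ⟪R τ v, v⟫, sq_nonneg ‖S τ v‖])
    s (left_mem_Icc.mpr hst) t (right_mem_Icc.mpr hst) hst
  linarith

/-- Comparison of two self-adjoint solutions of Riccati equations on a half-open interval on which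
both are defined. -/
theorem riccati_comparison_on_Ioc {R₁ R₂ S₁ S₂ : ℝ → E →L[ℝ] E} {b : ℝ} (hb : 0 < b)
    (hR₂ : Continuous R₂) (hR₁₂ : ∀ t v, 0 ≤ ⟪(R₁ t - R₂ t) v, v⟫)
    (hS₁sa : ∀ t ∈ Ioc 0 b, IsSelfAdjoint (S₁ t)) (hS₂sa : ∀ t ∈ Ioc 0 b, IsSelfAdjoint (S₂ t))
    (hS₁ : ∀ t ∈ Ioc 0 b, HasDerivAt S₁ (-(S₁ t * S₁ t) - R₁ t) t)
    (hS₂ : ∀ t ∈ Ioc 0 b, HasDerivAt S₂ (-(S₂ t * S₂ t) - R₂ t) t)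
    {U₀ : E →L[ℝ] E} (hU : Tendsto (fun t => S₂ t - S₁ t) (𝓝[>] 0) (𝓝 U₀))
    (hU₀ : ∀ v, 0 ≤ ⟪U₀ v, v⟫) :
    ∀ t ∈ Ioc 0 b, ∀ v, 0 ≤ ⟪(S₂ t - S₁ t) v, v⟫ := by
  obtain ⟨K, hK⟩ := (isCompact_Icc (a := 0) (b := b)).exists_bound_of_continuousOn hR₂.continuousOn
  have hK₀ : 0 ≤ K := (norm_nonneg _).trans (hK 0 (left_mem_Icc.mpr hb.le))
  obtain ⟨c, hc⟩ : ∃ c, ∀ t ∈ Ioc 0 b, ∀ v, -(c * ‖v‖ ^ 2) ≤ ⟪S₂ t v, v⟫ := by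
    refine ⟨‖S₂ b‖ + K * b, fun t ht v => ?_⟩
    have hsub : ∀ τ ∈ Icc t b, τ ∈ Ioc 0 b := fun τ hτ => ⟨ht.1.trans_le hτ.1, hτ.2⟩
    have h := inner_riccati_le ht.2 (fun τ hτ => hS₂sa τ (hsub τ hτ))
      (fun τ hτ => hS₂ τ (hsub τ hτ)) (fun τ hτ => hK τ (Ioc_subset_Icc_self (hsub τ hτ))) v
    have h₁ := abs_real_inner_le_norm (S₂ b v) v
    have h₂ : ‖S₂ b v‖ * ‖v‖ ≤ ‖S₂ b‖ * ‖v‖ * ‖v‖ :=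
      mul_le_mul_of_nonneg_right ((S₂ b).le_opNorm v) (norm_nonneg v)
    nlinarith [neg_abs_le ⟪S₂ b v, v⟫, mul_nonneg (mul_nonneg hK₀ (sq_nonneg ‖v‖)) ht.1.le]
  let U : ℝ → E →L[ℝ] E := Function.update (fun t => S₂ t - S₁ t) 0 U₀
  have hUzero : U 0 = U₀ := Function.update_self ..
  have hUne : ∀ t, t ≠ 0 → U t = S₂ t - S₁ t := fun t ht => Function.update_of_ne ht ..
  have hUderiv : ∀ t ∈ Ioc 0 b,
      HasDerivAt U ((-(S₂ t * S₂ t) - R₂ t) - (-(S₁ t * S₁ t) - R₁ t)) t := fun t ht =>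
    ((hS₂ t ht).sub (hS₁ t ht)).congr_of_eventuallyEq <| by
      filter_upwards [isOpen_ne.mem_nhds ht.1.ne'] with s hs using hUne s hs
  have hUcont : ContinuousOn U (Icc 0 b) := by
    refine continuousOn_update_iff.mpr ⟨fun t ht => ?_, fun _ => ?_⟩
    · have ht' : t ∈ Ioc 0 b := ⟨lt_of_le_of_ne ht.1.1 (Ne.symm ht.2), ht.1.2⟩
      exact ((hS₂ t ht').sub (hS₁ t ht')).continuousAt.continuousWithinAt
    · exact hU.mono_left (nhdsWithin_mono _ fun t ht => lt_of_le_of_ne ht.1.1 (Ne.symm ht.2))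
  have hperturb : ∀ ε > (0 : ℝ), ∀ t ∈ Icc 0 b, ∀ v, v ≠ 0 →
      0 < ⟪(U t + (ε * Real.exp ((2 * c + 1) * t)) • (1 : E →L[ℝ] E)) v, v⟫ := by
    intro ε hε
    have hexp : ∀ t : ℝ,
        HasDerivAt (fun t => (ε * Real.exp ((2 * c + 1) * t)) • (1 : E →L[ℝ] E))
          ((ε * Real.exp ((2 * c + 1) * t) * (2 * c + 1)) • (1 : E →L[ℝ] E)) t := fun t => by
      have h : HasDerivAt (fun t => ε * Real.exp ((2 * c + 1) * t))
          (ε * Real.exp ((2 * c + 1) * t) * (2 * c + 1)) t := by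
        simpa [mul_assoc] using (((hasDerivAt_id t).const_mul (2 * c + 1)).exp).const_mul ε
      exact h.smul_const (1 : E →L[ℝ] E)
    refine inner_pos_of_deriv_pos_on_ker
      (hUcont.add fun t _ => (hexp t).continuousAt.continuousWithinAt)
      (fun t ht => ?_) (fun t ht => (hUderiv t ht).add (hexp t)) (fun v hv => ?_)
      fun t ht v hv hker => ?_
    · rw [hUne t ht.1.ne']
      exact ((hS₂sa t ht).sub (hS₁sa t ht)).add ((IsSelfAdjoint.all _).smul (.one _))
    · have : 0 < ⟪v, v⟫ := real_inner_self_pos.mpr hv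
      have h := hU₀ v
      simp only [hUzero, mul_zero, Real.exp_zero, mul_one, add_apply, smul_apply,
        one_apply_eq_self, inner_add_left, real_inner_smul_left]
      positivity
    · have hk : 0 < ε * Real.exp ((2 * c + 1) * t) := by positivity
      set k := ε * Real.exp ((2 * c + 1) * t)
      have hv' : 0 < ‖v‖ ^ 2 := by positivity
      have hS₁v : S₁ t v = S₂ t v + k • v := by
        simp only [hUne t ht.1.ne', add_apply, sub_apply, smul_apply,
          one_apply_eq_self] at hker
        rw [← sub_eq_zero, ← neg_eq_zero, ← hker]
        abel
      have hsymm₁ : ⟪(S₁ t * S₁ t) v, v⟫ = ‖S₁ t v‖ ^ 2 :=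
        (ContinuousLinearMap.isSelfAdjoint_iff_isSymmetric.mp (hS₁sa t ht) (S₁ t v) v).trans
          (real_inner_self_eq_norm_sq _)
      have hsymm₂ : ⟪(S₂ t * S₂ t) v, v⟫ = ‖S₂ t v‖ ^ 2 :=
        (ContinuousLinearMap.isSelfAdjoint_iff_isSymmetric.mp (hS₂sa t ht) (S₂ t v) v).trans
          (real_inner_self_eq_norm_sq _)
      have hnorm : ‖S₁ t v‖ ^ 2 = ‖S₂ t v‖ ^ 2 + 2 * (k * ⟪S₂ t v, v⟫) + k ^ 2 * ‖v‖ ^ 2 := by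
        rw [hS₁v, norm_add_sq_real, real_inner_smul_right, norm_smul, mul_pow, Real.norm_eq_abs,
          sq_abs]
      have hR := hR₁₂ t v
      simp only [add_apply, sub_apply, neg_apply, smul_apply, one_apply_eq_self, inner_add_left,
        inner_sub_left, inner_neg_left, real_inner_smul_left, hsymm₁, hsymm₂, hnorm,
        real_inner_self_eq_norm_sq] at hR ⊢
      nlinarith [mul_le_mul_of_nonneg_left (hc t ht v) hk.le, mul_pos hk hv',
        mul_pos (pow_pos hk 2) hv']
  intro t ht v
  rcases eq_or_ne v 0 with rfl | hv
  · simp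
  have hlim : Tendsto
      (fun ε : ℝ => ⟪(U t + (ε * Real.exp ((2 * c + 1) * t)) • (1 : E →L[ℝ] E)) v, v⟫)
      (𝓝[>] 0) (𝓝 ⟪(S₂ t - S₁ t) v, v⟫) := by
    have hcont : Continuous
        (fun ε : ℝ => ⟪(U t + (ε * Real.exp ((2 * c + 1) * t)) • (1 : E →L[ℝ] E)) v, v⟫) := by
      fun_prop
    simpa [hUne t ht.1.ne'] using (hcont.tendsto 0).mono_left (nhdsWithin_le_nhds (s := Ioi 0))
  refine ge_of_tendsto hlim ?_
  filter_upwards [self_mem_nhdsWithin] with ε hε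
  exact (hperturb ε hε t (Ioc_subset_Icc_self ht) v hv).le

end

/-- **Riccati comparison (Eschenburg–Heintze), part 1.**
`E` is a finite-dimensional real inner product space; endomorphisms are modelled as
continuous linear maps `E →L[ℝ] E` (all linear maps are continuous in finite dimension).
`R₁, R₂ : ℝ → S(E)` are smooth with `R₁ ≥ R₂`; for `i = 1, 2`, `Sᵢ` is a self-adjoint
solution of `Sᵢ' + Sᵢ² + Rᵢ = 0` on `(0, tᵢ)` which cannot be extended beyond `tᵢ`;
`U = S₂ - S₁` extends continuously to `t = 0` with `U(0) ≥ 0`.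
Then `t₁ ≤ t₂` and `S₁(t) ≤ S₂(t)` for all `t ∈ (0, t₁)`. -/
theorem riccati_comparison_ineq
    {E : Type*} [NormedAddCommGroup E] [InnerProductSpace ℝ E] [FiniteDimensional ℝ E]
    (t₁ t₂ : ℝ) (ht₁ : 0 < t₁) (ht₂ : 0 < t₂)
    (R₁ R₂ : ℝ → E →L[ℝ] E)
    (hR₁smooth : ContDiff ℝ (⊤ : ℕ∞) R₁) (hR₂smooth : ContDiff ℝ (⊤ : ℕ∞) R₂)
    (hR₁sa : ∀ t : ℝ, IsSelfAdjoint (R₁ t)) (hR₂sa : ∀ t : ℝ, IsSelfAdjoint (R₂ t))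
    (hR₁₂ : ∀ t : ℝ, ∀ v : E, 0 ≤ ⟪(R₁ t - R₂ t) v, v⟫)
    (S₁ S₂ : ℝ → E →L[ℝ] E)
    (hS₁sa : ∀ t ∈ Set.Ioo (0 : ℝ) t₁, IsSelfAdjoint (S₁ t))
    (hS₂sa : ∀ t ∈ Set.Ioo (0 : ℝ) t₂, IsSelfAdjoint (S₂ t))
    (hS₁ : ∀ t ∈ Set.Ioo (0 : ℝ) t₁, HasDerivAt S₁ (-(S₁ t * S₁ t) - R₁ t) t)
    (hS₂ : ∀ t ∈ Set.Ioo (0 : ℝ) t₂, HasDerivAt S₂ (-(S₂ t * S₂ t) - R₂ t) t)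
    (hmax₁ : ∀ t' > t₁, ¬ ∃ S : ℝ → E →L[ℝ] E,
      (∀ t ∈ Set.Ioo (0 : ℝ) t', IsSelfAdjoint (S t)) ∧
      (∀ t ∈ Set.Ioo (0 : ℝ) t', HasDerivAt S (-(S t * S t) - R₁ t) t) ∧
      (∀ t ∈ Set.Ioo (0 : ℝ) t₁, S t = S₁ t))
    (hmax₂ : ∀ t' > t₂, ¬ ∃ S : ℝ → E →L[ℝ] E,
      (∀ t ∈ Set.Ioo (0 : ℝ) t', IsSelfAdjoint (S t)) ∧
      (∀ t ∈ Set.Ioo (0 : ℝ) t', HasDerivAt S (-(S t * S t) - R₂ t) t) ∧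
      (∀ t ∈ Set.Ioo (0 : ℝ) t₂, S t = S₂ t))
    (U₀ : E →L[ℝ] E)
    (hUcont : Filter.Tendsto (fun t => S₂ t - S₁ t)
      (nhdsWithin 0 (Set.Ioo 0 (min t₁ t₂))) (nhds U₀))
    (hU₀ : ∀ v : E, 0 ≤ ⟪U₀ v, v⟫) :
    t₁ ≤ t₂ ∧ ∀ t ∈ Set.Ioo (0 : ℝ) t₁, ∀ v : E, 0 ≤ ⟪(S₂ t - S₁ t) v, v⟫ := by
  have hcomp : ∀ t ∈ Ioo 0 (min t₁ t₂), ∀ v, 0 ≤ ⟪(S₂ t - S₁ t) v, v⟫ := by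
    intro t ht
    have h₁ : Ioc 0 t ⊆ Ioo 0 t₁ := fun s hs =>
      ⟨hs.1, hs.2.trans_lt (ht.2.trans_le (min_le_left _ _))⟩
    have h₂ : Ioc 0 t ⊆ Ioo 0 t₂ := fun s hs =>
      ⟨hs.1, hs.2.trans_lt (ht.2.trans_le (min_le_right _ _))⟩
    rw [nhdsWithin_Ioo_eq_nhdsGT (lt_min ht₁ ht₂)] at hUcont
    exact riccati_comparison_on_Ioc ht.1 hR₂smooth.continuous hR₁₂ (fun s hs => hS₁sa s (h₁ hs))
      (fun s hs => hS₂sa s (h₂ hs)) (fun s hs => hS₁ s (h₁ hs)) (fun s hs => hS₂ s (h₂ hs))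
      hUcont hU₀ t (right_mem_Ioc.mpr ht.1)
  have hle : t₁ ≤ t₂ := by
    by_contra! hlt
    rw [min_eq_right hlt.le] at hcomp
    obtain ⟨M, hM⟩ := (isCompact_Icc (a := t₂ / 2) (b := t₂)).exists_bound_of_continuousOn
      (f := S₁) fun t ht => (hS₁ t ⟨by linarith [ht.1], ht.2.trans_lt hlt⟩).continuousAt
        |>.continuousWithinAt
    obtain ⟨K, hK⟩ := (isCompact_Icc (a := t₂ / 2) (b := t₂)).exists_bound_of_continuousOn
      hR₂smooth.continuous.continuousOn
    have hmem : t₂ ∈ Icc (t₂ / 2) t₂ := ⟨by linarith, le_rfl⟩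
    have hM₀ : 0 ≤ M := (norm_nonneg _).trans (hM t₂ hmem)
    have hK₀ : 0 ≤ K := (norm_nonneg _).trans (hK t₂ hmem)
    have hform : ∀ (A : E →L[ℝ] E) (v : E), |⟪A v, v⟫| ≤ ‖A‖ * ‖v‖ ^ 2 := fun A v => by
      rw [pow_two, ← mul_assoc]
      exact (abs_real_inner_le_norm _ _).trans
        (mul_le_mul_of_nonneg_right (A.le_opNorm v) (norm_nonneg v))
    have hbound : ∀ t ∈ Ioo (t₂ / 2) t₂, ‖S₂ t‖ ≤ M + ‖S₂ (t₂ / 2)‖ + K * t₂ := by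
      intro t ht
      have ht' : t ∈ Ioo 0 t₂ := ⟨by linarith [ht.1], ht.2⟩
      have hsub : ∀ τ ∈ Icc (t₂ / 2) t, τ ∈ Ioo 0 t₂ := fun τ hτ =>
        ⟨by linarith [hτ.1], hτ.2.trans_lt ht.2⟩
      refine (hS₂sa t ht').norm_le_of_abs_inner_le (by positivity) fun v => ?_
      have hupper := inner_riccati_le ht.1.le (fun τ hτ => hS₂sa τ (hsub τ hτ))
        (fun τ hτ => hS₂ τ (hsub τ hτ)) (fun τ hτ => hK τ ⟨hτ.1, hτ.2.trans ht.2.le⟩) v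
      have hlower := hcomp t ht' v
      rw [sub_apply, inner_sub_left] at hlower
      have hS₁v := abs_le.mp (hform (S₁ t) v)
      have hS₂v := abs_le.mp (hform (S₂ (t₂ / 2)) v)
      have hMv := mul_le_mul_of_nonneg_right (hM t (Ioo_subset_Icc_self ht)) (sq_nonneg ‖v‖)
      have hKv : K * ‖v‖ ^ 2 * (t - t₂ / 2) ≤ K * ‖v‖ ^ 2 * t₂ :=
        mul_le_mul_of_nonneg_left (by linarith [ht.2]) (by positivity)
      have hMv₀ : 0 ≤ M * ‖v‖ ^ 2 := by positivity
      have hSv₀ : 0 ≤ ‖S₂ (t₂ / 2)‖ * ‖v‖ ^ 2 := by positivity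
      have hKv₀ : 0 ≤ K * ‖v‖ ^ 2 * t₂ := by positivity
      rw [abs_le]
      constructor <;> linarith
    obtain ⟨T, hT, hext⟩ := exists_riccati_extension (hR₂smooth.of_le (by exact_mod_cast le_top))
      hR₂sa (half_pos ht₂).le (half_lt_self ht₂) hS₂sa hS₂ hbound
    exact hmax₂ T hT hext
  exact ⟨hle, by rwa [min_eq_left hle] at hcomp⟩
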